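/- None of the three polynomials [[t1,t2][t3,t4],t5], [t1,t2][t3,t4][t5,t6], and s4(t1,t2,t3,t4) is a polynomial identity of M11(E); that is, for each of these polynomials there exists a substitution of elements of M11(E) for the variables under which it takes a nonzero value. -/

import Mathlib

noncomputable section

open CliffordAlgebra

/-- The Grassmann algebra of an infinite-dimensional vector space (free on countably many
generators); its even part is `evenOdd 0 0` and its odd part is `evenOdd 0 1`. -/
abbrev GrassmannAlg (K : Type*) [Field K] := ExteriorAlgebra K (ℕ →₀ K)

/-- `M11(E)`: the subalgebra of 2×2 matrices over the Grassmann algebra `E` whose diagonal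
entries are even and whose off-diagonal entries are odd. -/
def M11 (K : Type*) [Field K] :
    Subalgebra K (Matrix (Fin 2) (Fin 2) (GrassmannAlg K)) where
  carrier := {A | A 0 0 ∈ evenOdd (0 : QuadraticForm K (ℕ →₀ K)) 0 ∧
                  A 1 1 ∈ evenOdd (0 : QuadraticForm K (ℕ →₀ K)) 0 ∧
                  A 0 1 ∈ evenOdd (0 : QuadraticForm K (ℕ →₀ K)) 1 ∧
                  A 1 0 ∈ evenOdd (0 : QuadraticForm K (ℕ →₀ K)) 1}
  add_mem' := by
    rintro A B ⟨h1, h2, h3, h4⟩ ⟨g1, g2, g3, g4⟩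
    exact ⟨add_mem h1 g1, add_mem h2 g2, add_mem h3 g3, add_mem h4 g4⟩
  mul_mem' := by
    rintro A B ⟨h1, h2, h3, h4⟩ ⟨g1, g2, g3, g4⟩
    have e00 : ((0 : ZMod 2) + 0) = 0 := by decide
    have e11 : ((1 : ZMod 2) + 1) = 0 := by decide
    have e01 : ((0 : ZMod 2) + 1) = 1 := by decide
    have e10 : ((1 : ZMod 2) + 0) = 1 := by decide
    refine ⟨?_, ?_, ?_, ?_⟩ <;>
      simp only [Set.mem_setOf_eq, Matrix.mul_apply, Fin.sum_univ_two]
    · exact add_mem (e00 ▸ SetLike.mul_mem_graded h1 g1)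
        (e11 ▸ SetLike.mul_mem_graded h3 g4)
    · exact add_mem (e11 ▸ SetLike.mul_mem_graded h4 g3)
        (e00 ▸ SetLike.mul_mem_graded h2 g2)
    · exact add_mem (e01 ▸ SetLike.mul_mem_graded h1 g3)
        (e10 ▸ SetLike.mul_mem_graded h3 g2)
    · exact add_mem (e10 ▸ SetLike.mul_mem_graded h4 g1)
        (e01 ▸ SetLike.mul_mem_graded h2 g4)
  algebraMap_mem' := by
    intro r
    refine ⟨?_, ?_, ?_, ?_⟩ <;>
      simp only [Set.mem_setOf_eq, Matrix.algebraMap_matrix_apply]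
    · simpa using SetLike.algebraMap_mem_graded (evenOdd (0 : QuadraticForm K (ℕ →₀ K))) r
    · simpa using SetLike.algebraMap_mem_graded (evenOdd (0 : QuadraticForm K (ℕ →₀ K))) r
    · simp [zero_mem (evenOdd (0 : QuadraticForm K (ℕ →₀ K)) 1)]
    · simp [zero_mem (evenOdd (0 : QuadraticForm K (ℕ →₀ K)) 1)]

/-- `adIter c l z` is the left-normed commutator `[z, c, c, ..., c]` with `l` occurrences
of `c`; so `adIter a l [a,b] = [a, b, a^(l)]`. -/
def adIter {A : Type*} [Ring A] (c : A) (l : ℕ) (z : A) : A :=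
  (fun w => w * c - c * w)^[l] z

def gx (K : Type*) [Field K] (i : ℕ) : GrassmannAlg K :=
  ExteriorAlgebra.ι K (Finsupp.single i (1 : K))

lemma gx_odd (K : Type*) [Field K] (i : ℕ) :
    gx K i ∈ evenOdd (0 : QuadraticForm K (ℕ →₀ K)) 1 :=
  ι_mem_evenOdd_one _ _

lemma gx_swap (K : Type*) [Field K] (i j : ℕ) : gx K i * gx K j = - (gx K j * gx K i) :=
  eq_neg_of_add_eq_zero_left (ExteriorAlgebra.ι_add_mul_swap _ _)

lemma gx_ne (K : Type*) [Field K] : gx K 0 * (gx K 1 * gx K 2) ≠ 0 := by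
  intro h
  let L : (ℕ →₀ K) →ₗ[K] (Fin 3 → K) :=
    LinearMap.pi fun k => Finsupp.lapply (k : ℕ)
  let f : ∀ i, (ℕ →₀ K) [⋀^Fin i]→ₗ[K] K := fun i =>
    if hi : i = 3 then by
      subst hi
      exact (Matrix.detRowAlternating (n := Fin 3) (R := K)).compLinearMap L
    else 0
  have h2 := ExteriorAlgebra.liftAlternating_apply_ιMulti f
    (fun k : Fin 3 => Finsupp.single (k : ℕ) (1 : K))
  have h3 : ExteriorAlgebra.ιMulti K 3 (fun k : Fin 3 => Finsupp.single (k : ℕ) (1 : K)) = 0 := by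
    rw [← h, ExteriorAlgebra.ιMulti_apply]
    simp [List.ofFn_succ, gx]
  rw [h3, map_zero] at h2
  have h4 : (Matrix.of fun i j : Fin 3 => L (Finsupp.single (i : ℕ) (1 : K)) j) = 1 := by
    ext i j
    fin_cases i <;> fin_cases j <;> simp [L]
  have h5 : f 3 (fun k : Fin 3 => Finsupp.single (k : ℕ) (1 : K)) =
      Matrix.det (Matrix.of fun i j : Fin 3 => L (Finsupp.single (i : ℕ) (1 : K)) j) := rfl
  rw [h5, h4, Matrix.det_one] at h2
  exact zero_ne_one h2

lemma mem_h (K : Type*) [Field K] : !![(1 : GrassmannAlg K), 0; 0, 0] ∈ M11 K := by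
  refine ⟨?_, zero_mem _, zero_mem _, zero_mem _⟩
  exact SetLike.one_mem_graded (evenOdd (0 : QuadraticForm K (ℕ →₀ K)))

lemma mem_u (K : Type*) [Field K] (i : ℕ) : !![0, gx K i; 0, 0] ∈ M11 K :=
  ⟨zero_mem _, zero_mem _, gx_odd K i, zero_mem _⟩

lemma mem_v (K : Type*) [Field K] (i : ℕ) : !![0, 0; gx K i, 0] ∈ M11 K :=
  ⟨zero_mem _, zero_mem _, zero_mem _, gx_odd K i⟩

set_option maxHeartbeats 4000000 in
lemma s4_expand {R : Type*} [Ring R] (a : Fin 4 → R) :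
    ∑ σ : Equiv.Perm (Fin 4),
        (Equiv.Perm.sign σ : ℤ) • (a (σ 0) * a (σ 1) * a (σ 2) * a (σ 3)) =
    ((a 0 * a 1 - a 1 * a 0) * (a 2 * a 3 - a 3 * a 2)
      + (a 2 * a 3 - a 3 * a 2) * (a 0 * a 1 - a 1 * a 0))
    - ((a 0 * a 2 - a 2 * a 0) * (a 1 * a 3 - a 3 * a 1)
      + (a 1 * a 3 - a 3 * a 1) * (a 0 * a 2 - a 2 * a 0))
    + ((a 0 * a 3 - a 3 * a 0) * (a 1 * a 2 - a 2 * a 1)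
      + (a 1 * a 2 - a 2 * a 1) * (a 0 * a 3 - a 3 * a 0)) := by
  have d2 : ∀ (p : Fin 4) (e : Equiv.Perm (Fin 3)), Equiv.Perm.decomposeFin.symm (p, e) 2 =
      Equiv.swap 0 p (e 1).succ := fun p e => Equiv.Perm.decomposeFin_symm_apply_succ e p 1
  have d3 : ∀ (p : Fin 4) (e : Equiv.Perm (Fin 3)), Equiv.Perm.decomposeFin.symm (p, e) 3 =
      Equiv.swap 0 p (e 2).succ := fun p e => Equiv.Perm.decomposeFin_symm_apply_succ e p 2
  have d4 : ∀ (p : Fin 3) (e : Equiv.Perm (Fin 2)), Equiv.Perm.decomposeFin.symm (p, e) 2 =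
      Equiv.swap 0 p (e 1).succ := fun p e => Equiv.Perm.decomposeFin_symm_apply_succ e p 1
  simp only [Finset.univ_perm_fin_succ, Finset.sum_map, Finset.univ_product_univ.symm,
    Finset.sum_product, Fin.sum_univ_succ]
  simp [d2, d3, d4, Equiv.Perm.decomposeFin.symm_sign, Equiv.swap_apply_def, Fin.ext_iff,
    Equiv.Perm.decomposeFin_symm_apply_zero, Fin.succ_ne_zero]
  noncomm_ring

/- STATEMENT 7: none of [[t1,t2][t3,t4],t5], [t1,t2][t3,t4][t5,t6], s4 is a polynomial
identity of M11(E). -/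
theorem stmt7 (K : Type*) [Field K] [CharZero K] :
    (∃ a₁ a₂ a₃ a₄ a₅ : Matrix (Fin 2) (Fin 2) (GrassmannAlg K),
      a₁ ∈ M11 K ∧ a₂ ∈ M11 K ∧ a₃ ∈ M11 K ∧ a₄ ∈ M11 K ∧ a₅ ∈ M11 K ∧
      ((a₁ * a₂ - a₂ * a₁) * (a₃ * a₄ - a₄ * a₃)) * a₅
        - a₅ * ((a₁ * a₂ - a₂ * a₁) * (a₃ * a₄ - a₄ * a₃)) ≠ 0)
    ∧ (∃ a₁ a₂ a₃ a₄ a₅ a₆ : Matrix (Fin 2) (Fin 2) (GrassmannAlg K),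
      a₁ ∈ M11 K ∧ a₂ ∈ M11 K ∧ a₃ ∈ M11 K ∧ a₄ ∈ M11 K ∧ a₅ ∈ M11 K ∧ a₆ ∈ M11 K ∧
      (a₁ * a₂ - a₂ * a₁) * (a₃ * a₄ - a₄ * a₃) * (a₅ * a₆ - a₆ * a₅) ≠ 0)
    ∧ (∃ a : Fin 4 → Matrix (Fin 2) (Fin 2) (GrassmannAlg K),
      (∀ i, a i ∈ M11 K) ∧
      ∑ σ : Equiv.Perm (Fin 4),
        (Equiv.Perm.sign σ : ℤ) • (a (σ 0) * a (σ 1) * a (σ 2) * a (σ 3)) ≠ 0) := by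
  have hne := gx_ne K
  refine ⟨⟨!![1, 0; 0, 0], !![0, gx K 0; 0, 0], !![1, 0; 0, 0], !![0, 0; gx K 1, 0],
      !![0, gx K 2; 0, 0], mem_h K, mem_u K 0, mem_h K, mem_v K 1, mem_u K 2, ?_⟩,
    ⟨!![1, 0; 0, 0], !![0, gx K 0; 0, 0], !![1, 0; 0, 0], !![0, 0; gx K 1, 0],
      !![1, 0; 0, 0], !![0, gx K 2; 0, 0], mem_h K, mem_u K 0, mem_h K, mem_v K 1,
      mem_h K, mem_u K 2, ?_⟩,
    ⟨![!![1, 0; 0, 0], !![0, gx K 0; 0, 0], !![0, 0; gx K 1, 0], !![0, gx K 2; 0, 0]], ?_, ?_⟩⟩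
  · intro h
    have h1 := congrFun (congrFun h 0) 1
    simp [Matrix.mul_apply, mul_assoc] at h1
    exact hne h1
  · intro h
    have h1 := congrFun (congrFun h 0) 1
    simp [Matrix.mul_apply, mul_assoc] at h1
    exact hne h1
  · intro i
    fin_cases i
    · exact mem_h K
    · exact mem_u K 0
    · exact mem_v K 1
    · exact mem_u K 2
  · rw [s4_expand]
    intro h
    have h1 := congrFun (congrFun h 0) 1
    simp [Matrix.mul_apply, mul_assoc] at h1
    have e1 : gx K 2 * (gx K 0 * gx K 1) = gx K 0 * (gx K 1 * gx K 2) := by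
      rw [← mul_assoc, gx_swap K 2 0, neg_mul, mul_assoc, gx_swap K 2 1, mul_neg, neg_neg]
    have e2 : gx K 2 * (gx K 1 * gx K 0) = - (gx K 0 * (gx K 1 * gx K 2)) := by
      rw [gx_swap K 1 0, mul_neg, e1]
    have e3 : gx K 0 * (gx K 2 * gx K 1) = - (gx K 0 * (gx K 1 * gx K 2)) := by
      rw [gx_swap K 2 1, mul_neg]
    have e4 : gx K 1 * (gx K 2 * gx K 0) = gx K 0 * (gx K 1 * gx K 2) := by
      rw [gx_swap K 2 0, mul_neg, ← mul_assoc, gx_swap K 1 0, neg_mul, neg_neg, mul_assoc]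
    have e5 : gx K 1 * (gx K 0 * gx K 2) = - (gx K 0 * (gx K 1 * gx K 2)) := by
      rw [← mul_assoc, gx_swap K 1 0, neg_mul, mul_assoc]
    simp only [e1, e2, e3, e4, e5] at h1
    have h2 : (4 : K) • (gx K 0 * (gx K 1 * gx K 2)) = 0 := by
      rw [← h1]; module
    rcases smul_eq_zero.mp h2 with h3 | h3
    · norm_num at h3
    · exact hne h3
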